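/- Let A = (a_1, …, a_r) be a tuple of positive integers with r ≥ 3, and let L_A be the quotient of the free abelian group on generators x_1, …, x_r by the subgroup generated by a_i x_i − a_j x_j for all i, j, with canonical element c := a_1 x_1 = … = a_r x_r. For x ∈ L_A write x ≥ 0 if in its (unique) normal form x = l·c + Σ_{i=1}^r l_i·x_i with 0 ≤ l_i < a_i one has l ≥ 0. Then: (1) the set {x ∈ L_A : x ≥ 0} coincides with the submonoid of L_A generated by x_1, …, x_r (i.e., the set of all N-linear combinations of the x_i); (2) if x ≥ 0 and −x ≥ 0 then x = 0. Consequently, the relation x ≤ y defined by y − x ≥ 0 is a translation-invariant partial order on L_A. -/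

import Mathlib

/-- The subgroup of relations `a_i x_i − a_j x_j` in the free abelian group on `r` letters. -/
noncomputable def orbRels (r : ℕ) (a : Fin r → ℕ) : AddSubgroup (Fin r →₀ ℤ) :=
  AddSubgroup.closure
    {z | ∃ i j : Fin r, z = (a i : ℤ) • Finsupp.single i 1 - (a j : ℤ) • Finsupp.single j 1}

/-- The group `L_A`: the free abelian group on `x_1, …, x_r` modulo `a_i x_i = a_j x_j`. -/
abbrev LGroup (r : ℕ) (a : Fin r → ℕ) : Type := (Fin r →₀ ℤ) ⧸ orbRels r a

/-- The image of the generator `x_i` in `L_A`. -/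
noncomputable def LGen (r : ℕ) (a : Fin r → ℕ) (i : Fin r) : LGroup r a :=
  QuotientAddGroup.mk (Finsupp.single i 1)

/-- `x ≥ 0` in `L_A`: the coefficient of `c` in the normal form of `x` is nonnegative. -/
def LNonneg (r : ℕ) (a : Fin r → ℕ) (c : LGroup r a) (x : LGroup r a) : Prop :=
  ∃ l : ℤ, ∃ li : Fin r → ℕ, 0 ≤ l ∧ (∀ i, li i < a i) ∧
    x = l • c + ∑ i, (li i) • LGen r a i

/-- The degree map `L_A → ℤ`, sending `x_i` to `∏_{j ≠ i} a_j`. -/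
noncomputable def LDegree (r : ℕ) (a : Fin r → ℕ) : LGroup r a →+ ℤ :=
  QuotientAddGroup.lift (orbRels r a)
    (Finsupp.liftAddHom fun i : Fin r =>
      AddMonoidHom.mulRight (∏ j ∈ Finset.univ.erase i, (a j : ℤ)))
    (by
      rw [orbRels, AddSubgroup.closure_le]
      rintro z ⟨i, j, rfl⟩
      have h : ∀ i : Fin r, (a i : ℤ) * ∏ j ∈ Finset.univ.erase i, (a j : ℤ) = ∏ j, (a j : ℤ) :=
        fun i => Finset.mul_prod_erase _ (fun j => (a j : ℤ)) (Finset.mem_univ i)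
      rw [SetLike.mem_coe, AddMonoidHom.mem_ker, map_sub, map_zsmul, map_zsmul]
      simp [h])

theorem LDegree_LGen (r : ℕ) (a : Fin r → ℕ) (i : Fin r) :
    LDegree r a (LGen r a i) = ∏ j ∈ Finset.univ.erase i, (a j : ℤ) := by
  change Finsupp.liftAddHom _ (Finsupp.single i (1 : ℤ)) = _
  simp

theorem LDegree_LGen_pos {r : ℕ} {a : Fin r → ℕ} (ha : ∀ i, 0 < a i) (i : Fin r) :
    0 < LDegree r a (LGen r a i) := by
  rw [LDegree_LGen]
  exact Finset.prod_pos fun j _ => by exact_mod_cast ha j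

/-- A vanishing `ℕ`-linear combination of the generators is trivial. -/
theorem eq_zero_of_sum_nsmul_LGen_eq_zero {r : ℕ} {a : Fin r → ℕ} (ha : ∀ i, 0 < a i)
    {m : Fin r → ℕ} (h : ∑ i, m i • LGen r a i = 0) (i : Fin r) : m i = 0 := by
  have hdeg := congrArg (LDegree r a) h
  simp only [map_sum, map_nsmul, map_zero] at hdeg
  rw [Finset.sum_eq_zero_iff_of_nonneg
    fun j _ => nsmul_nonneg (LDegree_LGen_pos ha j).le _] at hdeg
  have hi := hdeg i (Finset.mem_univ i)
  rw [nsmul_eq_mul, mul_eq_zero] at hi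
  exact_mod_cast hi.resolve_right (LDegree_LGen_pos ha i).ne'

theorem LNonneg_iff_exists_sum {r : ℕ} {a : Fin r → ℕ} (hr : 0 < r) (ha : ∀ i, 0 < a i)
    {c : LGroup r a} (hc : ∀ i, c = a i • LGen r a i) (x : LGroup r a) :
    LNonneg r a c x ↔ ∃ m : Fin r → ℕ, x = ∑ i, m i • LGen r a i := by
  constructor
  · rintro ⟨l, li, hl, -, rfl⟩
    lift l to ℕ using hl
    let i₀ : Fin r := ⟨0, hr⟩
    refine ⟨fun i => (if i = i₀ then l * a i₀ else 0) + li i, ?_⟩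
    simp only [add_smul, Finset.sum_add_distrib, ite_smul, zero_smul, Finset.sum_ite_eq',
      Finset.mem_univ, if_true, natCast_zsmul]
    rw [mul_smul, ← hc i₀]
  · rintro ⟨m, rfl⟩
    refine ⟨((∑ i, m i / a i : ℕ) : ℤ), fun i => m i % a i, by positivity,
      fun i => Nat.mod_lt _ (ha i), ?_⟩
    rw [natCast_zsmul, Finset.sum_smul, ← Finset.sum_add_distrib]
    refine Finset.sum_congr rfl fun i _ => ?_
    rw [hc i, ← mul_smul, ← add_smul, Nat.div_add_mod']

theorem LNonneg.add {r : ℕ} {a : Fin r → ℕ} (hr : 0 < r) (ha : ∀ i, 0 < a i)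
    {c : LGroup r a} (hc : ∀ i, c = a i • LGen r a i) {x y : LGroup r a}
    (hx : LNonneg r a c x) (hy : LNonneg r a c y) : LNonneg r a c (x + y) := by
  rw [LNonneg_iff_exists_sum hr ha hc] at *
  obtain ⟨m, rfl⟩ := hx
  obtain ⟨n, rfl⟩ := hy
  exact ⟨fun i => m i + n i, by simp only [add_smul, Finset.sum_add_distrib]⟩

theorem LNonneg.eq_zero_of_neg {r : ℕ} {a : Fin r → ℕ} (hr : 0 < r) (ha : ∀ i, 0 < a i)
    {c : LGroup r a} (hc : ∀ i, c = a i • LGen r a i) {x : LGroup r a}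
    (hx : LNonneg r a c x) (hx' : LNonneg r a c (-x)) : x = 0 := by
  rw [LNonneg_iff_exists_sum hr ha hc] at hx hx'
  obtain ⟨m, hm⟩ := hx
  obtain ⟨n, hn⟩ := hx'
  have h : ∑ i, (m i + n i) • LGen r a i = 0 := by
    simp only [add_smul, Finset.sum_add_distrib]
    rw [← hm, ← hn, add_neg_cancel]
  rw [hm]
  refine Finset.sum_eq_zero fun i _ => ?_
  rw [(Nat.add_eq_zero_iff.mp (eq_zero_of_sum_nsmul_LGen_eq_zero ha h i)).1, zero_nsmul]

/-- (1) the nonnegative elements of `L_A` are exactly the `ℕ`-linear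
combinations of `x_1, …, x_r`; (2) if `x ≥ 0` and `−x ≥ 0` then `x = 0`; consequently
`x ≤ y ↔ y − x ≥ 0` is a translation-invariant partial order on `L_A`. -/
theorem nonneg_cone (r : ℕ) (hr : 3 ≤ r)
    (a : Fin r → ℕ) (ha : ∀ i, 0 < a i)
    (c : LGroup r a) (hc : ∀ i, c = a i • LGen r a i) :
    (∀ x : LGroup r a,
      LNonneg r a c x ↔ ∃ m : Fin r → ℕ, x = ∑ i, (m i) • LGen r a i) ∧
    (∀ x : LGroup r a, LNonneg r a c x → LNonneg r a c (-x) → x = 0) ∧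
    IsPartialOrder (LGroup r a) (fun x y => LNonneg r a c (y - x)) ∧
    (∀ x y z : LGroup r a,
      LNonneg r a c (y - x) → LNonneg r a c ((y + z) - (x + z))) := by
  have hr₀ : 0 < r := by omega
  refine ⟨LNonneg_iff_exists_sum hr₀ ha hc, fun x => LNonneg.eq_zero_of_neg hr₀ ha hc,
    { refl := fun x => ?_, trans := fun x y z hxy hyz => ?_, antisymm := fun x y hxy hyx => ?_ },
    fun x y z h => ?_⟩
  · exact (LNonneg_iff_exists_sum hr₀ ha hc _).mpr ⟨fun _ => 0, by simp⟩
  · rw [← sub_add_sub_cancel z y x]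
    exact LNonneg.add hr₀ ha hc hyz hxy
  · rw [← neg_sub] at hyx
    exact (sub_eq_zero.mp (LNonneg.eq_zero_of_neg hr₀ ha hc hxy hyx)).symm
  · rwa [add_sub_add_right_eq_sub]
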